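/- arXiv:2507.12875 — 2 statements merged into one kernel-verified Lean document; each statement's English description precedes it below -/
import Mathlib

section
/- Let f : (k+1)^V → ℝ be a nonnegative monotone k-submodular function with f(0) = 0 and let c be a cost function on V. Let o ∈ (k+1)^V with c(o) > 0 and let 0 = s^{(0)} ⪯ s^{(1)} ⪯ … ⪯ s^{(m)} = s be a greedy sequence relative to o. If β = c(s)/c(o), then f(s) ≥ min{β/2, 1/2}·f(o). -/
open Finset

section KSubmodularDefs

variable {V : Type*} [Fintype V] [DecidableEq V] {k : ℕ}

/-- The support of a `k`-tuple `x : V → Fin (k+1)` (value `0` means "not selected"). -/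
def ksupp (x : V → Fin (k+1)) : Finset V := Finset.univ.filter fun e => x e ≠ 0

/-- The meet `x ⊓ y`. -/
def kinf (x y : V → Fin (k+1)) : V → Fin (k+1) :=
  fun e => if x e = y e then x e else 0

/-- The join `x ⊔ y`. -/
def ksup (x y : V → Fin (k+1)) : V → Fin (k+1) :=
  fun e => if y e = 0 ∨ y e = x e then x e else if x e = 0 then y e else 0

/-- `f` is `k`-submodular. -/
def KSubmodular (f : (V → Fin (k+1)) → ℝ) : Prop :=
  ∀ x y : V → Fin (k+1), f (ksup x y) + f (kinf x y) ≤ f x + f y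

/-- The partial order `x ⪯ y` on `(k+1)^V`. -/
def kle (x y : V → Fin (k+1)) : Prop := ∀ e : V, x e = 0 ∨ x e = y e

/-- `f` is monotone with respect to `⪯`. -/
def KMonotone (f : (V → Fin (k+1)) → ℝ) : Prop :=
  ∀ x y : V → Fin (k+1), kle x y → f x ≤ f y

/-- The marginal gain `Δ_{e,j}(x)` of assigning element `e` to component `j`. -/
def margin (f : (V → Fin (k+1)) → ℝ) (x : V → Fin (k+1)) (e : V) (j : Fin (k+1)) : ℝ :=
  f (Function.update x e j) - f x

/-- The total cost `c(x)` of a tuple. -/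
def kcost (c : V → ℝ) (x : V → Fin (k+1)) : ℝ := ∑ e ∈ ksupp x, c e

/-- One step of a greedy sequence relative to `o`: pick `e ∉ supp x` and `j ∈ {1,…,k}`
maximizing the marginal gain over components (a), and with marginal density at least that of
every pair `(e', j')` with `e' ∈ supp o \ supp x` (b). -/
def GreedyStep (f : (V → Fin (k+1)) → ℝ) (c : V → ℝ) (o : V → Fin (k+1))
    (x x' : V → Fin (k+1)) : Prop :=
  ∃ e : V, ∃ j : Fin (k+1), x e = 0 ∧ j ≠ 0 ∧ x' = Function.update x e j ∧
    (∀ j' : Fin (k+1), j' ≠ 0 → margin f x e j' ≤ margin f x e j) ∧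
    (∀ e' : V, o e' ≠ 0 → x e' = 0 → ∀ j' : Fin (k+1), j' ≠ 0 →
      margin f x e' j' * c e ≤ margin f x e j * c e')

/-- `GreedyRun f c B s V0 out`: starting from partial solution `s` with remaining elements `V0`,
the greedy procedure with budget `B` (under some tie-breaking) can terminate with output `out`.
At each step a pair `(e, j)` of maximum marginal density among remaining elements is chosen;
`e` is added (placed in component `j`) iff it fits in the remaining budget, and is removed
from the remaining pool in either case. -/
inductive GreedyRun (f : (V → Fin (k+1)) → ℝ) (c : V → ℝ) (B : ℝ) :
    (V → Fin (k+1)) → Finset V → (V → Fin (k+1)) → Prop where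
  | done (s : V → Fin (k+1)) : GreedyRun f c B s ∅ s
  | take (s : V → Fin (k+1)) (V0 : Finset V) (e : V) (j : Fin (k+1))
      (out : V → Fin (k+1)) (he : e ∈ V0) (hj : j ≠ 0)
      (hbest : ∀ e' ∈ V0, ∀ j' : Fin (k+1), j' ≠ 0 →
        margin f s e' j' / c e' ≤ margin f s e j / c e)
      (hfit : kcost c s + c e ≤ B)
      (hrest : GreedyRun f c B (Function.update s e j) (V0.erase e) out) :
      GreedyRun f c B s V0 out
  | skip (s : V → Fin (k+1)) (V0 : Finset V) (e : V) (j : Fin (k+1))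
      (out : V → Fin (k+1)) (he : e ∈ V0) (hj : j ≠ 0)
      (hbest : ∀ e' ∈ V0, ∀ j' : Fin (k+1), j' ≠ 0 →
        margin f s e' j' / c e' ≤ margin f s e j / c e)
      (hnofit : ¬ kcost c s + c e ≤ B)
      (hrest : GreedyRun f c B s (V0.erase e) out) :
      GreedyRun f c B s V0 out

/-- The `k`-multilinear extension of `f`, as a function of `x : V → Fin (k+1) → ℝ`
(only the coordinates `x e j` with `j ≠ 0` are relevant). -/
noncomputable def kext (f : (V → Fin (k+1)) → ℝ) (x : V → Fin (k+1) → ℝ) : ℝ :=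
  ∑ s : V → Fin (k+1), f s *
    ∏ e : V,
      (if s e = 0 then 1 - ∑ j ∈ Finset.univ.erase (0 : Fin (k+1)), x e j else x e (s e))

/-- The partial derivative of `F` with respect to the coordinate `(e, j)` at the point `x`. -/
noncomputable def pderiv (F : (V → Fin (k+1) → ℝ) → ℝ) (e : V) (j : Fin (k+1))
    (x : V → Fin (k+1) → ℝ) : ℝ :=
  deriv (fun t : ℝ => F (Function.update x e (Function.update (x e) j t))) (x e j)

/-- Membership in the domain `Δ_k^V` of the multilinear extension. -/
def inSimplex (x : V → Fin (k+1) → ℝ) : Prop :=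
  (∀ e : V, ∀ j : Fin (k+1), j ≠ 0 → 0 ≤ x e j ∧ x e j ≤ 1) ∧
  (∀ e : V, ∑ j ∈ Finset.univ.erase (0 : Fin (k+1)), x e j ≤ 1)

end KSubmodularDefs

section GreedyAnalysis

variable {V : Type*} [Fintype V] [DecidableEq V] {k : ℕ}

/-- The tuple that agrees with `x` on the support of `x` and with `o` elsewhere. -/
def koverride (x o : V → Fin (k+1)) : V → Fin (k+1) :=
  fun e => if x e = 0 then o e else x e

/-- The part of the support of `o` not yet covered by `x`. -/
def kresidual (x o : V → Fin (k+1)) : Finset V :=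
  Finset.univ.filter fun e => o e ≠ 0 ∧ x e = 0

/-- Marginal gains of a `k`-submodular function decrease along `⪯`. -/
theorem KSubmodular.margin_anti {f : (V → Fin (k+1)) → ℝ} (hsub : KSubmodular f)
    {x y : V → Fin (k+1)} (hxy : kle x y) {e : V} (he : y e = 0) (j : Fin (k+1)) :
    margin f y e j ≤ margin f x e j := by
  have hxe : x e = 0 := by
    rcases hxy e with h | h
    · exact h
    · rw [h, he]
  by_cases hj : j = 0
  · subst hj
    have hx : Function.update x e 0 = x := by rw [← hxe]; exact Function.update_eq_self e x
    have hy : Function.update y e 0 = y := by rw [← he]; exact Function.update_eq_self e y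
    simp [margin, hx, hy]
  have hsup : ksup (Function.update x e j) y = Function.update y e j := by
    funext v
    by_cases hv : v = e
    · subst hv; simp [ksup, he]
    · rcases hxy v with h | h
      · simp only [ksup, Function.update_of_ne hv, h]
        grind
      · simp [ksup, Function.update_of_ne hv, h]
  have hinf : kinf (Function.update x e j) y = x := by
    funext v
    by_cases hv : v = e
    · subst hv; simp [kinf, he, hj, hxe]
    · rcases hxy v with h | h
      · simp only [kinf, Function.update_of_ne hv, h]
        grind
      · simp [kinf, Function.update_of_ne hv, h]
  have h := hsub (Function.update x e j) y
  rw [hsup, hinf] at h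
  unfold margin
  linarith

theorem KSubmodular.koverride_le_sum_margin {f : (V → Fin (k+1)) → ℝ} (hsub : KSubmodular f)
    (x o : V → Fin (k+1)) :
    f (koverride x o) - f x ≤ ∑ e ∈ kresidual x o, margin f x e (o e) := by
  have key : ∀ T ⊆ kresidual x o,
      f (fun e => if e ∈ T then o e else x e) - f x ≤ ∑ e ∈ T, margin f x e (o e) := by
    intro T
    induction T using Finset.induction_on with
    | empty => simp
    | insert a T ha ih =>
      intro hT
      have hT' : T ⊆ kresidual x o := (Finset.subset_insert a T).trans hT
      have hax : x a = 0 := by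
        have := hT (Finset.mem_insert_self a T)
        simp only [kresidual, Finset.mem_filter] at this
        exact this.2.2
      set y : V → Fin (k+1) := fun e => if e ∈ T then o e else x e with hy
      have hxy : kle x y := by
        intro v
        by_cases hv : v ∈ T
        · have := hT' hv
          simp only [kresidual, Finset.mem_filter] at this
          exact Or.inl this.2.2
        · exact Or.inr (by simp [hy, hv])
      have hya : y a = 0 := by simp [hy, ha, hax]
      have hupd : (fun e => if e ∈ insert a T then o e else x e) =
          Function.update y a (o a) := by
        funext v
        by_cases hv : v = a
        · subst hv; simp
        · simp [hv, hy]
      have h1 := hsub.margin_anti hxy hya (o a)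
      have h2 := ih hT'
      rw [Finset.sum_insert ha, hupd]
      unfold margin at h1 h2 ⊢
      linarith
  have h := key (kresidual x o) subset_rfl
  have heq : (fun e => if e ∈ kresidual x o then o e else x e) = koverride x o := by
    funext v
    simp only [kresidual, koverride, Finset.mem_filter, Finset.mem_univ, true_and]
    grind
  rwa [heq] at h

theorem kcost_update (c : V → ℝ) {x : V → Fin (k+1)} {e : V} {j : Fin (k+1)}
    (he : x e = 0) (hj : j ≠ 0) :
    kcost c (Function.update x e j) = kcost c x + c e := by
  have h : ksupp (Function.update x e j) = insert e (ksupp x) := by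
    ext v
    by_cases hv : v = e
    · subst hv; simp [ksupp, hj]
    · simp [ksupp, hv]
  unfold kcost
  rw [h, Finset.sum_insert (by simp [ksupp, he])]
  ring

theorem sum_kresidual_update_of_ne (c : V → ℝ) {x o : V → Fin (k+1)} {e : V} {j : Fin (k+1)}
    (he : x e = 0) (hj : j ≠ 0) (ho : o e ≠ 0) :
    ∑ v ∈ kresidual (Function.update x e j) o, c v = ∑ v ∈ kresidual x o, c v - c e := by
  have h : kresidual x o = insert e (kresidual (Function.update x e j) o) := by
    ext v
    by_cases hv : v = e
    · subst hv; simp [kresidual, he, ho]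
    · simp [kresidual, hv]
  rw [h, Finset.sum_insert (by simp [kresidual, hj])]
  ring

theorem kresidual_update_of_eq {x o : V → Fin (k+1)} {e : V} (j : Fin (k+1)) (ho : o e = 0) :
    kresidual (Function.update x e j) o = kresidual x o := by
  ext v
  by_cases hv : v = e
  · subst hv; simp [kresidual, ho]
  · simp [kresidual, hv]

theorem koverride_update (x o : V → Fin (k+1)) (e : V) {j : Fin (k+1)} (hj : j ≠ 0) :
    koverride (Function.update x e j) o = Function.update (koverride x o) e j := by
  funext v
  by_cases hv : v = e
  · subst hv; simp [koverride, hj]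
  · simp [koverride, hv]

/-- Overriding one more coordinate of `o` costs at most the greedy gain. -/
theorem f_koverride_le {f : (V → Fin (k+1)) → ℝ} (hsub : KSubmodular f) (hmono : KMonotone f)
    {x o : V → Fin (k+1)} {e : V} {j : Fin (k+1)} (he : x e = 0) (hj : j ≠ 0)
    (hbest : margin f x e (o e) ≤ margin f x e j) :
    f (koverride x o) ≤ f (koverride (Function.update x e j) o) + margin f x e j := by
  set w := Function.update (koverride x o) e 0 with hw
  have hxw : kle x w := by
    intro v
    by_cases hv : v = e
    · subst hv; exact Or.inl he
    · simp only [hw, Function.update_of_ne hv, koverride]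
      grind
  have h1 := hsub.margin_anti hxw (by simp [hw] : w e = 0) (o e)
  have hwo : Function.update w e (o e) = koverride x o := by
    funext v
    by_cases hv : v = e
    · subst hv; simp [koverride, he]
    · simp [hw, hv]
  have h2 : f w ≤ f (koverride (Function.update x e j) o) := by
    apply hmono
    intro v
    rw [koverride_update x o e hj]
    by_cases hv : v = e
    · subst hv; simp [hw]
    · simp [hw, hv]
  have h3 : margin f w e (o e) = f (koverride x o) - f w := by rw [margin, hwo]
  linarith

theorem f_koverride_le_of_eq_zero {f : (V → Fin (k+1)) → ℝ} (hmono : KMonotone f)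
    {x o : V → Fin (k+1)} {e : V} {j : Fin (k+1)} (he : x e = 0) (hj : j ≠ 0) (ho : o e = 0) :
    f (koverride x o) ≤ f (koverride (Function.update x e j) o) := by
  apply hmono
  intro v
  rw [koverride_update x o e hj]
  by_cases hv : v = e
  · subst hv; simp [koverride, he, ho]
  · simp [hv]

/-- State of a greedy sequence: `A` and `B` are the gains collected from elements inside and
outside `supp o`, and `b` is the cost of the elements outside `supp o`. -/
structure GreedyInvariant (f : (V → Fin (k+1)) → ℝ) (c : V → ℝ) (o x : V → Fin (k+1))
    (A B b : ℝ) : Prop where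
  nonneg_outside : 0 ≤ B
  nonneg_cost : 0 ≤ b
  value : A + B = f x
  cost : ∑ e ∈ kresidual x o, c e + kcost c x = kcost c o + b
  loss : f o ≤ f (koverride x o) + A
  density : f o - 2 * A - B ≤ 0 ∨
    ((f o - 2 * A - B) * kcost c o ≤ f o * ∑ e ∈ kresidual x o, c e ∧
      b * (f o - 2 * A - B) ≤ B * ∑ e ∈ kresidual x o, c e)

theorem GreedyInvariant.gap_le {f : (V → Fin (k+1)) → ℝ} (hsub : KSubmodular f) {c : V → ℝ}
    {o x : V → Fin (k+1)} {A B b : ℝ} (h : GreedyInvariant f c o x A B b) :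
    f o - 2 * A - B ≤ ∑ e ∈ kresidual x o, margin f x e (o e) := by
  have := hsub.koverride_le_sum_margin x o
  linarith [h.loss, h.value]

theorem GreedyInvariant.residual_pos {f : (V → Fin (k+1)) → ℝ} (hsub : KSubmodular f)
    {c : V → ℝ} (hc : ∀ e, 0 < c e) {o x : V → Fin (k+1)} {A B b : ℝ}
    (h : GreedyInvariant f c o x A B b) (hG : 0 < f o - 2 * A - B) :
    0 < ∑ e ∈ kresidual x o, c e := by
  refine Finset.sum_pos (fun e _ => hc e) ?_
  by_contra hne
  have h1 := h.gap_le hsub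
  rw [Finset.not_nonempty_iff_eq_empty.mp hne, Finset.sum_empty] at h1
  linarith

theorem GreedyInvariant.zero {f : (V → Fin (k+1)) → ℝ} (hzero : f (fun _ => 0) = 0)
    (c : V → ℝ) (o : V → Fin (k+1)) : GreedyInvariant f c o (fun _ => 0) 0 0 0 := by
  have hr : kresidual (fun _ => 0) o = ksupp o := by simp [kresidual, ksupp]
  have hov : koverride (fun _ => 0) o = o := by funext v; simp [koverride]
  refine ⟨le_rfl, le_rfl, by simp [hzero], ?_, by simp [hov], Or.inr ⟨?_, by simp⟩⟩
  · simp [hr, kcost, ksupp]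
  · simp [hr, kcost]

theorem GreedyInvariant.step {f : (V → Fin (k+1)) → ℝ} (hsub : KSubmodular f)
    (hmono : KMonotone f) {c : V → ℝ} (hc : ∀ e, 0 < c e) {o x x' : V → Fin (k+1)}
    (hco : 0 < kcost c o) {A B b : ℝ} (h : GreedyInvariant f c o x A B b)
    (hstep : GreedyStep f c o x x') :
    ∃ A' B' b', GreedyInvariant f c o x' A' B' b' := by
  obtain ⟨e, j, he, hj, rfl, hbest, hdens⟩ := hstep
  have hd : 0 ≤ margin f x e j := by
    have : f x ≤ f (Function.update x e j) := by
      apply hmono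
      intro v
      by_cases hv : v = e
      · subst hv; exact Or.inl he
      · simp [hv]
    unfold margin
    linarith
  have hval : f (Function.update x e j) = f x + margin f x e j := by unfold margin; ring
  have hrate : (f o - 2 * A - B) * c e ≤ margin f x e j * ∑ v ∈ kresidual x o, c v := by
    calc (f o - 2 * A - B) * c e
        ≤ (∑ v ∈ kresidual x o, margin f x v (o v)) * c e :=
          mul_le_mul_of_nonneg_right (h.gap_le hsub) (hc e).le
      _ ≤ margin f x e j * ∑ v ∈ kresidual x o, c v := by
          rw [Finset.sum_mul, Finset.mul_sum]
          refine Finset.sum_le_sum fun v hv => ?_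
          simp only [kresidual, Finset.mem_filter, Finset.mem_univ, true_and] at hv
          exact hdens v hv.1 hv.2 (o v) hv.1
  have hce := hc e
  have hcost := h.cost
  have hB := h.nonneg_outside
  have hb := h.nonneg_cost
  have hpos := h.residual_pos hsub hc
  by_cases ho : o e = 0
  · refine ⟨A, B + margin f x e j, b + c e, by linarith, by linarith, ?_, ?_, ?_, ?_⟩
    · rw [hval]; linarith [h.value]
    · rw [kresidual_update_of_eq j ho, kcost_update c he hj]; linarith
    · linarith [h.loss, f_koverride_le_of_eq_zero hmono he hj ho]
    · rw [kresidual_update_of_eq j ho]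
      by_cases hG : f o - 2 * A - B ≤ 0
      · left; linarith
      obtain ⟨h1, h2⟩ := h.density.resolve_left hG
      right
      constructor
      · nlinarith [mul_nonneg hd hco.le]
      · nlinarith [mul_nonneg hd hb, mul_nonneg hd hce.le]
  · refine ⟨A + margin f x e j, B, b, hB, hb, ?_, ?_, ?_, ?_⟩
    · rw [hval]; linarith [h.value]
    · rw [sum_kresidual_update_of_ne c he hj ho, kcost_update c he hj]; linarith
    · linarith [h.loss, f_koverride_le hsub hmono he hj (hbest (o e) ho)]
    · have hres := sum_kresidual_update_of_ne c he hj ho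
      have hres0 : 0 ≤ ∑ v ∈ kresidual (Function.update x e j) o, c v :=
        Finset.sum_nonneg fun v _ => (hc v).le
      rw [hres] at hres0 ⊢
      by_cases hG : f o - 2 * A - B ≤ 0
      · left; linarith
      obtain ⟨h1, h2⟩ := h.density.resolve_left hG
      have hR := hpos (not_le.mp hG)
      set R := ∑ v ∈ kresidual x o, c v
      set d := margin f x e j
      set G := f o - 2 * A - B with hGdef
      have hG' : f o - 2 * (A + d) - B = G - 2 * d := by rw [hGdef]; ring
      rw [hG']
      have hshrink : (G - 2 * d) * R ≤ G * (R - c e) := by nlinarith [mul_nonneg hd hR.le]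
      right
      constructor
      · refine le_of_mul_le_mul_right ?_ hR
        calc (G - 2 * d) * kcost c o * R = (G - 2 * d) * R * kcost c o := by ring
          _ ≤ G * (R - c e) * kcost c o := mul_le_mul_of_nonneg_right hshrink hco.le
          _ = G * kcost c o * (R - c e) := by ring
          _ ≤ f o * R * (R - c e) := mul_le_mul_of_nonneg_right h1 hres0
          _ = f o * (R - c e) * R := by ring
      · refine le_of_mul_le_mul_right ?_ hR
        calc b * (G - 2 * d) * R = b * ((G - 2 * d) * R) := by ring
          _ ≤ b * (G * (R - c e)) := mul_le_mul_of_nonneg_left hshrink hb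
          _ = b * G * (R - c e) := by ring
          _ ≤ B * R * (R - c e) := mul_le_mul_of_nonneg_right h2 hres0
          _ = B * (R - c e) * R := by ring

theorem GreedyInvariant.ratio_le {f : (V → Fin (k+1)) → ℝ} (hsub : KSubmodular f)
    {c : V → ℝ} (hc : ∀ e, 0 < c e) {o x : V → Fin (k+1)} (hfo : 0 ≤ f o)
    (hco : 0 < kcost c o) {A B b : ℝ} (h : GreedyInvariant f c o x A B b) :
    min (kcost c x / kcost c o / 2) (1 / 2) * f o ≤ f x := by
  have hB := h.nonneg_outside
  have hval := h.value
  have half : f o ≤ 2 * f x → min (kcost c x / kcost c o / 2) (1 / 2) * f o ≤ f x := by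
    intro hle
    have := mul_le_mul_of_nonneg_right (min_le_right (kcost c x / kcost c o / 2) (1 / 2)) hfo
    linarith
  by_cases hG : f o - 2 * A - B ≤ 0
  · exact half (by linarith)
  obtain ⟨h1, h2⟩ := h.density.resolve_left hG
  have hR := h.residual_pos hsub hc (not_le.mp hG)
  have hcost := h.cost
  push Not at hG
  set R := ∑ v ∈ kresidual x o, c v
  have hgap : (f o - 2 * f x) * R ≤ (f o - 2 * A - B) * (kcost c o - kcost c x) := by
    have h3 : kcost c o - kcost c x = R - b := by linarith
    rw [h3, ← hval]
    linarith
  by_cases ht : kcost c o ≤ kcost c x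
  · apply half
    have : (f o - 2 * f x) * R ≤ 0 :=
      hgap.trans (mul_nonpos_of_nonneg_of_nonpos hG.le (by linarith))
    linarith [nonpos_of_mul_nonpos_left this hR]
  push Not at ht
  have hfin : (f o - 2 * f x) * kcost c o ≤ f o * (kcost c o - kcost c x) := by
    refine le_of_mul_le_mul_right ?_ hR
    calc (f o - 2 * f x) * kcost c o * R = (f o - 2 * f x) * R * kcost c o := by ring
      _ ≤ (f o - 2 * A - B) * (kcost c o - kcost c x) * kcost c o :=
          mul_le_mul_of_nonneg_right hgap hco.le
      _ = (f o - 2 * A - B) * kcost c o * (kcost c o - kcost c x) := by ring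
      _ ≤ f o * R * (kcost c o - kcost c x) :=
          mul_le_mul_of_nonneg_right h1 (by linarith)
      _ = f o * (kcost c o - kcost c x) * R := by ring
  calc min (kcost c x / kcost c o / 2) (1 / 2) * f o
      ≤ kcost c x / kcost c o / 2 * f o :=
        mul_le_mul_of_nonneg_right (min_le_left _ _) hfo
    _ = kcost c x * f o / (2 * kcost c o) := by field_simp
    _ ≤ f x := by
        rw [div_le_iff₀ (by linarith)]
        linarith

end GreedyAnalysis

/-- If `s` is obtained by a greedy sequence (relative to `o`) starting from `0`,
`c(o) > 0` and `β = c(s)/c(o)`, then `f(s) ≥ min{β/2, 1/2}·f(o)`. -/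
theorem greedy_ratio_lemma_monotone
    {V : Type*} [Fintype V] [DecidableEq V] {k : ℕ} (hk : 1 ≤ k)
    (f : (V → Fin (k+1)) → ℝ)
    (hsub : KSubmodular f) (hmono : KMonotone f)
    (hnonneg : ∀ x : V → Fin (k+1), 0 ≤ f x) (hzero : f (fun _ => 0) = 0)
    (c : V → ℝ) (hc : ∀ e : V, 0 < c e)
    (o : V → Fin (k+1)) (hco : 0 < kcost c o)
    (m : ℕ) (s : ℕ → V → Fin (k+1))
    (h0 : s 0 = fun _ => 0)
    (hstep : ∀ i < m, GreedyStep f c o (s i) (s (i+1)))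
    (β : ℝ) (hβ : β = kcost c (s m) / kcost c o) :
    min (β / 2) (1 / 2) * f o ≤ f (s m) := by
  have hinv : ∀ i ≤ m, ∃ A B b, GreedyInvariant f c o (s i) A B b := by
    intro i
    induction i with
    | zero => exact fun _ => ⟨0, 0, 0, h0 ▸ GreedyInvariant.zero hzero c o⟩
    | succ i ih =>
      intro hi
      obtain ⟨A, B, b, h⟩ := ih (by omega)
      exact h.step hsub hmono hc hco (hstep i (by omega))
  obtain ⟨A, B, b, h⟩ := hinv m le_rfl
  rw [hβ]
  exact h.ratio_le hsub hc (hnonneg o) hco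
end

section
/- Let k ≥ 2, let f : (k+1)^V → ℝ be a nonnegative k-submodular function (not necessarily monotone) with f(0) = 0, and let c be a cost function on V. Let o ∈ (k+1)^V and let 0 = s^{(0)} ⪯ s^{(1)} ⪯ … ⪯ s^{(m)} = s be a greedy sequence relative to o. If c(s) = c(o), then 3·f(s) ≥ f(o). -/
open Finset

section KSubmodularGreedy

variable {V : Type*} {k : ℕ}

theorem mem_ksupp [Fintype V] {x : V → Fin (k+1)} {e : V} : e ∈ ksupp x ↔ x e ≠ 0 := by
  simp [ksupp]

theorem kle_trans {x y z : V → Fin (k+1)} (hxy : kle x y) (hyz : kle y z) : kle x z := by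
  intro a
  have h1 := hxy a
  have h2 := hyz a
  grind

theorem kle_update [DecidableEq V] {x : V → Fin (k+1)} {e : V} (hx : x e = 0) (j : Fin (k+1)) :
    kle x (Function.update x e j) := by
  intro a
  by_cases ha : a = e
  · exact Or.inl (ha ▸ hx)
  · exact Or.inr (by simp [ha])

/-- Orthant submodularity: marginal gains decrease along `⪯`. -/
theorem KSubmodular.margin_le_of_kle [DecidableEq V]
    {f : (V → Fin (k+1)) → ℝ} (hsub : KSubmodular f)
    {x y : V → Fin (k+1)} (hxy : kle x y) {e : V} (hy : y e = 0) (j : Fin (k+1)) :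
    margin f y e j ≤ margin f x e j := by
  have hx : x e = 0 := by
    have := hxy e
    grind
  have h := hsub (Function.update x e j) y
  have hs : ksup (Function.update x e j) y = Function.update y e j := by
    funext a
    have := hxy a
    by_cases ha : a = e
    · subst ha
      simp [ksup, hy]
    · simp only [ksup, Function.update_of_ne ha]
      grind
  have hi : kinf (Function.update x e j) y = x := by
    funext a
    have := hxy a
    by_cases ha : a = e
    · subst ha
      simp only [kinf, Function.update_self]
      grind
    · simp only [kinf, Function.update_of_ne ha]
      grind
  rw [hs, hi] at h
  unfold margin
  linarith

/-- Pairwise monotonicity. -/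
theorem KSubmodular.margin_add_margin_nonneg [DecidableEq V]
    {f : (V → Fin (k+1)) → ℝ} (hsub : KSubmodular f)
    {x : V → Fin (k+1)} {e : V} (hx : x e = 0) {i j : Fin (k+1)} (hi : i ≠ 0) (hj : j ≠ 0)
    (hij : i ≠ j) : 0 ≤ margin f x e i + margin f x e j := by
  have h := hsub (Function.update x e i) (Function.update x e j)
  have hsup : ksup (Function.update x e i) (Function.update x e j) = x := by
    funext a
    by_cases ha : a = e
    · subst ha
      simp only [ksup, Function.update_self]
      grind
    · simp [ksup, Function.update_of_ne ha]
  have hinf : kinf (Function.update x e i) (Function.update x e j) = x := by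
    funext a
    by_cases ha : a = e
    · subst ha
      simp only [kinf, Function.update_self]
      grind
    · simp [kinf, Function.update_of_ne ha]
  rw [hsup, hinf] at h
  unfold margin
  linarith

theorem exists_ne_zero_ne (hk : 2 ≤ k) (j : Fin (k+1)) : ∃ i : Fin (k+1), i ≠ 0 ∧ i ≠ j := by
  by_cases h : j.val = 1
  · exact ⟨⟨2, by omega⟩, by simp [Fin.ext_iff], by simp [Fin.ext_iff, h]⟩
  · refine ⟨⟨1, by omega⟩, by simp [Fin.ext_iff], ?_⟩
    simp only [ne_eq, Fin.ext_iff]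
    omega

/-- If `j` is a best component for `e` at `x`, the gain at any `y ⪰ x` not containing `e` is
at least the negative of the gain at `x`. -/
theorem KSubmodular.neg_margin_le [DecidableEq V]
    {f : (V → Fin (k+1)) → ℝ} (hsub : KSubmodular f) (hk : 2 ≤ k)
    {x y : V → Fin (k+1)} (hxy : kle x y) {e : V} (hy : y e = 0) {j : Fin (k+1)} (hj : j ≠ 0)
    (hbest : ∀ i : Fin (k+1), i ≠ 0 → margin f x e i ≤ margin f x e j) :
    -margin f y e j ≤ margin f x e j := by
  obtain ⟨i, hi, hij⟩ := exists_ne_zero_ne hk j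
  have h1 := hsub.margin_add_margin_nonneg hy hi hj hij
  have h2 := hsub.margin_le_of_kle hxy hy i
  have h3 := hbest i hi
  linarith

/-- The tuple `o` overwritten by `s`, equal to `(o ⊔ s) ⊔ s`. -/
def koverwrite (o s : V → Fin (k+1)) : V → Fin (k+1) :=
  fun e => if s e = 0 then o e else s e

/-- Overwriting one more element `e` of `o` loses at most twice the gain of `e`, and at most
once this gain if `e ∉ supp o`. -/
theorem KSubmodular.koverwrite_update [DecidableEq V]
    {f : (V → Fin (k+1)) → ℝ} (hsub : KSubmodular f)
    (hk : 2 ≤ k) (o : V → Fin (k+1)) {x : V → Fin (k+1)} {e : V} {j : Fin (k+1)}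
    (hx : x e = 0) (hj : j ≠ 0)
    (hbest : ∀ i : Fin (k+1), i ≠ 0 → margin f x e i ≤ margin f x e j) :
    f (koverwrite o x) ≤ f (koverwrite o (Function.update x e j)) +
      (if o e = 0 then 1 else 2) * margin f x e j := by
  set t : V → Fin (k+1) := Function.update (koverwrite o x) e 0 with ht
  have hte : t e = 0 := by simp [ht]
  have hxt : kle x t := by
    intro a
    by_cases ha : a = e
    · exact Or.inl (ha ▸ hx)
    · simp only [ht, Function.update_of_ne ha, koverwrite]
      grind
  have hold : koverwrite o x = Function.update t e (o e) := by
    funext a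
    by_cases ha : a = e
    · subst ha
      simp [koverwrite, hx]
    · simp [ht, Function.update_of_ne ha]
  have hnew : koverwrite o (Function.update x e j) = Function.update t e j := by
    funext a
    by_cases ha : a = e
    · subst ha
      simp [koverwrite, hj]
    · simp [ht, Function.update_of_ne ha, koverwrite]
  have h1 := hsub.neg_margin_le hk hxt hte hj hbest
  rw [hold, hnew]
  split_ifs with ho
  · have : Function.update t e (o e) = t := by rw [ho, ← hte, Function.update_eq_self]
    rw [this]
    unfold margin at h1 ⊢
    linarith
  · have h2 := hsub.margin_le_of_kle hxt hte (o e)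
    have h3 := hbest (o e) ho
    unfold margin at h1 h2 h3 ⊢
    linarith

theorem KSubmodular.le_add_sum_margin [DecidableEq V]
    {f : (V → Fin (k+1)) → ℝ} (hsub : KSubmodular f)
    (o s : V → Fin (k+1)) (T : Finset V) (hT : ∀ e ∈ T, s e = 0) :
    f (fun e => if e ∈ T then o e else s e) ≤ f s + ∑ e ∈ T, margin f s e (o e) := by
  induction T using Finset.induction_on with
  | empty => simp
  | insert a T ha ih =>
    have ih := ih fun e he => hT e (Finset.mem_insert_of_mem he)
    set y : V → Fin (k+1) := fun e => if e ∈ T then o e else s e with hy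
    have hya : y a = 0 := by simp [hy, ha, hT a (Finset.mem_insert_self a T)]
    have hsy : kle s y := by
      intro e
      by_cases he : e ∈ T
      · exact Or.inl (hT e (Finset.mem_insert_of_mem he))
      · exact Or.inr (by simp [hy, he])
    have hupd : (fun e => if e ∈ insert a T then o e else s e) =
        Function.update y a (o a) := by
      funext e
      by_cases he : e = a
      · subst he
        simp
      · simp [hy, he]
    have h := hsub.margin_le_of_kle hsy hya (o a)
    rw [hupd, Finset.sum_insert ha]
    have : margin f y a (o a) = f (Function.update y a (o a)) - f y := rfl
    linarith

theorem KSubmodular.koverwrite_le [Fintype V] [DecidableEq V]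
    {f : (V → Fin (k+1)) → ℝ} (hsub : KSubmodular f)
    (o s : V → Fin (k+1)) :
    f (koverwrite o s) ≤ f s + ∑ e ∈ ksupp o \ ksupp s, margin f s e (o e) := by
  have h := hsub.le_add_sum_margin o s (ksupp o \ ksupp s) (by simp [mem_ksupp])
  convert h using 2
  funext e
  simp only [koverwrite, Finset.mem_sdiff, mem_ksupp]
  grind

theorem GreedyStep.kle [DecidableEq V]
    {f : (V → Fin (k+1)) → ℝ} {c : V → ℝ} {o x x' : V → Fin (k+1)}
    (h : GreedyStep f c o x x') : kle x x' := by
  obtain ⟨e, j, hx, -, rfl, -⟩ := h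
  exact kle_update hx j

theorem kle_of_greedyStep [DecidableEq V]
    {f : (V → Fin (k+1)) → ℝ} {c : V → ℝ} {o : V → Fin (k+1)} {m : ℕ}
    {s : ℕ → V → Fin (k+1)} (hstep : ∀ i < m, GreedyStep f c o (s i) (s (i+1)))
    {i : ℕ} (hi : i ≤ m) : kle (s i) (s m) := by
  induction hi using Nat.decreasingInduction with
  | self => exact fun _ => Or.inr rfl
  | of_succ i hi ih => exact kle_trans (hstep i hi).kle ih

theorem GreedyStep.koverwrite_add_le [Fintype V] [DecidableEq V]
    {f : (V → Fin (k+1)) → ℝ} (hsub : KSubmodular f)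
    (hk : 2 ≤ k) {c : V → ℝ} {o x x' : V → Fin (k+1)} (h : GreedyStep f c o x x') {r : ℝ}
    (hr : ∀ e j, x e = 0 → x' = Function.update x e j →
      (∀ e' : V, o e' ≠ 0 → x e' = 0 → ∀ j' : Fin (k+1), j' ≠ 0 →
        margin f x e' j' * c e ≤ margin f x e j * c e') →
      0 ≤ margin f x e j → r * c e ≤ margin f x e j) :
    f (koverwrite o x) + 2 * f x + r * ∑ e ∈ ksupp x' \ ksupp o, c e ≤
      f (koverwrite o x') + 2 * f x' + r * ∑ e ∈ ksupp x \ ksupp o, c e := by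
  obtain ⟨e, j, hx, hj, hx', hbest, hdens⟩ := h
  have hgain : 0 ≤ margin f x e j := by
    have := hsub.neg_margin_le hk (fun _ => Or.inr rfl) hx hj hbest
    linarith
  have hre := hr e j hx hx' hdens hgain
  subst hx'
  have hloss := hsub.koverwrite_update hk o hx hj hbest
  have hdef : margin f x e j = f (Function.update x e j) - f x := rfl
  have hsupp : ksupp (Function.update x e j) = insert e (ksupp x) := by
    ext a
    by_cases ha : a = e
    · subst ha
      simp [mem_ksupp, hj]
    · simp [mem_ksupp, ha]
  rw [hsupp]
  by_cases ho : o e = 0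
  · rw [Finset.insert_sdiff_of_notMem _ (by simp [mem_ksupp, ho]),
      Finset.sum_insert (by simp [mem_ksupp, hx])]
    rw [if_pos ho] at hloss
    linarith
  · rw [Finset.insert_sdiff_of_mem _ (by simp [mem_ksupp, ho])]
    rw [if_neg ho] at hloss
    linarith

end KSubmodularGreedy

/-- **Key lemma, non-monotone case.** For `k ≥ 2` and a nonnegative
(not necessarily monotone) `k`-submodular `f` with `f(0)=0`: if `s` is obtained by a greedy
sequence (relative to `o`) starting from `0` and `c(s) = c(o)`, then `3·f(s) ≥ f(o)`. -/
theorem greedy_key_lemma_nonmonotone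
    {V : Type*} [Fintype V] [DecidableEq V] {k : ℕ} (hk : 2 ≤ k)
    (f : (V → Fin (k+1)) → ℝ)
    (hsub : KSubmodular f)
    (hnonneg : ∀ x : V → Fin (k+1), 0 ≤ f x) (hzero : f (fun _ => 0) = 0)
    (c : V → ℝ) (hc : ∀ e : V, 0 < c e)
    (o : V → Fin (k+1)) (m : ℕ) (s : ℕ → V → Fin (k+1))
    (h0 : s 0 = fun _ => 0)
    (hstep : ∀ i < m, GreedyStep f c o (s i) (s (i+1)))
    (hcost : kcost c (s m) = kcost c o) :
    f o ≤ 3 * f (s m) := by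
  set A := ksupp o \ ksupp (s m) with hA
  obtain ⟨r, hrA, hr⟩ : ∃ r : ℝ, (∀ e ∈ A, margin f (s m) e (o e) ≤ r * c e) ∧
      (r = 0 ∨ ∃ e ∈ A, r = margin f (s m) e (o e) / c e) := by
    rcases A.eq_empty_or_nonempty with h | h
    · exact ⟨0, by simp [h], Or.inl rfl⟩
    · obtain ⟨a, ha, hmax⟩ := A.exists_max_image (fun e => margin f (s m) e (o e) / c e) h
      exact ⟨_, fun e he => (div_le_iff₀ (hc e)).mp (hmax e he), Or.inr ⟨a, ha, rfl⟩⟩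
  have hinv : ∀ i ≤ m, f o + r * ∑ e ∈ ksupp (s i) \ ksupp o, c e ≤
      f (koverwrite o (s i)) + 2 * f (s i) := by
    intro i
    induction i with
    | zero =>
      intro _
      have : ksupp (fun _ : V => (0 : Fin (k+1))) = ∅ := by simp [ksupp]
      have hover : koverwrite o (fun _ => 0) = o := by
        funext e
        simp [koverwrite]
      simp [h0, hzero, this, hover]
    | succ i ih =>
      intro hi
      have hih := ih (by omega)
      have := (hstep i hi).koverwrite_add_le hsub hk (r := r) (by
        intro e j _ _ hdens hgain
        rcases hr with rfl | ⟨a, ha, rfl⟩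
        · simpa using hgain
        · obtain ⟨hoa, hsa⟩ : o a ≠ 0 ∧ s m a = 0 := by simpa [hA, mem_ksupp] using ha
          have hle := kle_of_greedyStep hstep (show i ≤ m by omega)
          have hia : s i a = 0 := by
            have := hle a
            grind
          have h1 := hsub.margin_le_of_kle hle hsa (o a)
          have h2 := hdens a hoa hia (o a) hoa
          rw [div_mul_eq_mul_div, div_le_iff₀ (hc a)]
          exact (mul_le_mul_of_nonneg_right h1 (hc e).le).trans h2)
      linarith
  have hfin := hinv m le_rfl
  have hover := hsub.koverwrite_le o (s m)
  have hsum : ∑ e ∈ A, margin f (s m) e (o e) ≤ r * ∑ e ∈ A, c e := by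
    rw [Finset.mul_sum]
    exact Finset.sum_le_sum hrA
  have hcosts : ∑ e ∈ ksupp (s m) \ ksupp o, c e = ∑ e ∈ A, c e := by
    have h1 := Finset.sum_inter_add_sum_sdiff (ksupp (s m)) (ksupp o) c
    have h2 := Finset.sum_inter_add_sum_sdiff (ksupp o) (ksupp (s m)) c
    rw [Finset.inter_comm] at h2
    unfold kcost at hcost
    linarith
  rw [hcosts] at hfin
  linarith
end
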